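/- Let g ≥ 1, let e_a ∈ ℂ, c ∈ ℂ with c ≠ 0 and e_a = −c, and let (e_{b_j}, e_{c_j}) for j = 1, …, g be complex numbers with (e_{b_j} − e_a)(e_{c_j} − e_a) = c² for every j. Fix φ ∈ ℂ and set x = e_a + c·exp(2iφ), y² = (x − e_a)·∏_{j=1}^{g}(x − e_{b_j})(x − e_{c_j}), and E_j(φ) = (e_{b_j} − e_a) + (e_{c_j} − e_a) − 2c·cos(2φ). If E_j(φ) ≠ 0 for all j, then y² ≠ 0 and (x^{g−1}·2ic·exp(2iφ))² / (4y²) = (4c·sin²(φ))^{g−1} / ∏_{j=1}^{g} E_j(φ). -/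

import Mathlib

open scoped BigOperators

theorem exp_two_mul_I_mul_two_cos (φ : ℂ) :
    Complex.exp (2 * Complex.I * φ) * (2 * Complex.cos (2 * φ))
      = Complex.exp (2 * Complex.I * φ) ^ 2 + 1 := by
  rw [Complex.two_cos, mul_add, ← Complex.exp_add, ← Complex.exp_add, ← Complex.exp_nat_mul]
  have h₁ : 2 * Complex.I * φ + 2 * φ * Complex.I = (2 : ℕ) * (2 * Complex.I * φ) := by
    push_cast; ring
  have h₂ : 2 * Complex.I * φ + -(2 * φ) * Complex.I = 0 := by ring
  rw [h₁, h₂, Complex.exp_zero]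

/-- Lemma 4.2 (branch-free squared form): when the `2g` branch points other
than `e_a` are grouped into `g` pairs `(e_{b_j}, e_{c_j})` each satisfying
`(e_{b_j}−e_a)(e_{c_j}−e_a) = c²` with `e_a = −c`, the genus-`g` differential
`du_g = x^{g−1}dx/(2y)` along `x = e_a + c·exp(2iφ)` satisfies
`(du_g/dφ)² = (4c·sin²φ)^{g−1} / ∏_j E_j(φ)`. -/
theorem genus_g_differential_reality_form
    (g : ℕ) (hg : 1 ≤ g) (ea c : ℂ) (hc : c ≠ 0) (hea : ea = -c)
    (eb ec : Fin g → ℂ)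
    (hpair : ∀ j, (eb j - ea) * (ec j - ea) = c ^ 2)
    (φ : ℂ) :
    let x : ℂ := ea + c * Complex.exp (2 * Complex.I * φ)
    let y2 : ℂ := (x - ea) * ∏ j : Fin g, (x - eb j) * (x - ec j)
    let E : Fin g → ℂ := fun j =>
      (eb j - ea) + (ec j - ea) - 2 * c * Complex.cos (2 * φ)
    (∀ j, E j ≠ 0) →
      y2 ≠ 0 ∧
      (x ^ (g - 1) * (2 * Complex.I * c * Complex.exp (2 * Complex.I * φ))) ^ 2 / (4 * y2)
        = (4 * c * Complex.sin φ ^ 2) ^ (g - 1) / ∏ j : Fin g, E j := by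
  intro x y2 E hE
  set w := Complex.exp (2 * Complex.I * φ)
  have hw0 : w ≠ 0 := Complex.exp_ne_zero _
  have hcos : w * (2 * Complex.cos (2 * φ)) = w ^ 2 + 1 := exp_two_mul_I_mul_two_cos φ
  have hcw : -(c * w) ≠ 0 := neg_ne_zero.mpr (mul_ne_zero hc hw0)
  have hfac : ∀ j, (x - eb j) * (x - ec j) = -(c * w) * E j := fun j => by
    simp only [x, E]
    linear_combination hpair j - c ^ 2 * hcos
  have hy2 : y2 = c * w * ((-(c * w)) ^ g * ∏ j, E j) := by
    simp only [y2, hfac, Finset.prod_mul_distrib, Finset.prod_const, Finset.card_univ,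
      Fintype.card_fin]
    simp only [x]
    ring
  have hP : ∏ j, E j ≠ 0 := Finset.prod_ne_zero_iff.mpr fun j _ => hE j
  have hy0 : y2 ≠ 0 := by
    rw [hy2]
    exact mul_ne_zero (mul_ne_zero hc hw0) (mul_ne_zero (pow_ne_zero _ hcw) hP)
  have hx2 : x ^ 2 = -(c * w) * (4 * c * Complex.sin φ ^ 2) := by
    rw [Complex.cos_two_mul] at hcos
    simp only [x, hea]
    linear_combination -c ^ 2 * hcos + 4 * c ^ 2 * w * Complex.sin_sq_add_cos_sq φ
  refine ⟨hy0, ?_⟩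
  have h4 : (4 : ℂ) ≠ 0 := by norm_num
  rw [div_eq_div_iff (mul_ne_zero h4 hy0) hP, mul_pow, ← pow_mul, mul_comm (g - 1) 2,
    pow_mul, hx2, mul_pow, hy2]
  obtain ⟨n, rfl⟩ : ∃ n, g = n + 1 := ⟨g - 1, by omega⟩
  rw [Nat.add_sub_cancel, pow_succ (-(c * w)) n]
  linear_combination 4 * (-(c * w)) ^ n * (4 * c * Complex.sin φ ^ 2) ^ n * c ^ 2 * w ^ 2 *
    (∏ j, E j) * Complex.I_sq
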